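/- Under the setup, suppose some component H of G*[U] is isomorphic to the 4-cycle C_4 with vertex set V(H). Then every vertex w ∈ W having at most two neighbors in V(H) satisfies x_w ≤ ((λ−1)/λ)·x_{u*}. -/

import Mathlib

open SimpleGraph Finset
open scoped Classical

/-- The spectral radius of a finite simple graph: the largest eigenvalue of its
adjacency matrix (expressed as the supremum of the set of eigenvalues). -/
noncomputable def specRad {V : Type*} [Fintype V] (G : SimpleGraph V) : ℝ :=
  sSup {t : ℝ | Module.End.HasEigenvalue (Matrix.toLin' (G.adjMatrix ℝ)) t}

/-- The fan graph `F₆ = K₁ ∨ P₅`: the path `0-1-2-3-4` together with the hub `5`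
adjacent to all of `0,…,4`. -/
def fan6 : SimpleGraph (Fin 6) :=
  SimpleGraph.fromRel (fun a b => b = 5 ∨ (b.val = a.val + 1 ∧ b.val ≤ 4))

/-- A graph is `F₆`-free if it contains no subgraph isomorphic to the fan `F₆`,
i.e. there is no injective graph homomorphism from `F₆` into it. -/
def F6Free {V : Type*} (G : SimpleGraph V) : Prop :=
  ¬ ∃ f : fan6 →g G, Function.Injective f

/-- The join `K₂ ∨ kK₁`: two adjacent vertices, each adjacent to `k` further
pairwise non-adjacent vertices. -/
def K2JoinEmpty (k : ℕ) : SimpleGraph (Fin 2 ⊕ Fin k) :=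
  SimpleGraph.fromRel (fun a b => a.isLeft ∨ b.isLeft)

/-- `dS G S v` is the number of neighbors of `v` lying in `S`. -/
noncomputable def dS {V : Type*} (G : SimpleGraph V) (S : Set V) (v : V) : ℕ :=
  (G.neighborSet v ∩ S).ncard

/-- `eIn G S` is the number of edges of the induced subgraph `G[S]`. -/
noncomputable def eIn {V : Type*} (G : SimpleGraph V) (S : Set V) : ℕ :=
  {e ∈ G.edgeSet | ∀ v ∈ e, v ∈ S}.ncard

/-- `eBetween G S T` is the number of edges with one endpoint in `S` and the
other in `T`. -/
noncomputable def eBetween {V : Type*} (G : SimpleGraph V) (S T : Set V) : ℕ :=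
  {e ∈ G.edgeSet | ∃ a ∈ S, ∃ b ∈ T, e = s(a, b)}.ncard

/-- `gamma G x ustar S = Σ_{u∈S} (d_S(u) - 1)·x_u/x_{u*} - e(S)`. -/
noncomputable def gamma {V : Type*} [Fintype V] (G : SimpleGraph V) (x : V → ℝ)
    (ustar : V) (S : Set V) : ℝ :=
  (∑ u ∈ S.toFinset, ((dS G S u : ℝ) - 1) * (x u / x ustar)) - eIn G S

/-- The star `K_{1,r}` with center `0` and `r` leaves. -/
def starGraph (r : ℕ) : SimpleGraph (Fin (r + 1)) :=
  SimpleGraph.fromRel (fun a _ => a = 0)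

/-- `K_{1,r} + e`: the star with center `0` and `r` leaves, plus an edge joining
the two leaves `1` and `2`. -/
def starPlusEdge (r : ℕ) : SimpleGraph (Fin (r + 1)) :=
  SimpleGraph.fromRel (fun a b => a = 0 ∨ (a = 1 ∧ b = 2))

/-- The double star `D_{a,b}`: centers `0` and `1` joined by an edge, `0` joined
to the `a` leaves `2,…,a+1`, and `1` joined to the `b` leaves `a+2,…,a+b+1`. -/
def doubleStar (a b : ℕ) : SimpleGraph (Fin (a + b + 2)) :=
  SimpleGraph.fromRel (fun u v =>
    (u.val = 0 ∧ v.val = 1) ∨ (u.val = 0 ∧ 2 ≤ v.val ∧ v.val < a + 2) ∨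
      (u.val = 1 ∧ a + 2 ≤ v.val))

/-- `K₄ - e`: the complete graph on 4 vertices minus the edge `{0,1}`. -/
def K4MinusE : SimpleGraph (Fin 4) :=
  SimpleGraph.fromRel (fun u v => ¬(u = 0 ∧ v = 1) ∧ ¬(u = 1 ∧ v = 0))

/-- No path on five vertices occurs as a subgraph. -/
def P5Free {T : Type*} (B : SimpleGraph T) : Prop :=
  ∀ a b c d e, [a, b, c, d, e].Nodup → B.Adj a b → B.Adj b c → B.Adj c d → B.Adj d e → False

/-- `p`, `q` are the vertices of degree three of a (not necessarily induced) `K₄ - e`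
whose remaining vertices are `r`, `t`. -/
structure IsDiamond {T : Type*} (B : SimpleGraph T) (p q r t : T) : Prop where
  pq : B.Adj p q
  pr : B.Adj p r
  pt : B.Adj p t
  qr : B.Adj q r
  qt : B.Adj q t
  rt : r ≠ t

theorem supp_subset_of_closed {T : Type*} {B : SimpleGraph T} (C : B.ConnectedComponent)
    (S : Set T) {v : T} (hv : v ∈ C.supp) (hvS : v ∈ S)
    (hS : ∀ a b, a ∈ S → B.Adj a b → b ∈ S) : C.supp ⊆ S := by
  intro u hu
  have hr : B.Reachable v u := by
    rw [SimpleGraph.ConnectedComponent.mem_supp_iff] at hu hv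
    exact SimpleGraph.ConnectedComponent.exact (hv.trans hu.symm)
  obtain ⟨p⟩ := hr
  induction p with
  | nil => exact hvS
  | cons h p ih =>
    exact ih ((C.mem_supp_congr_adj h).1 hv) (hS _ _ hvS h) hu

theorem supp_eq_of_four_cycle {T : Type*} {B : SimpleGraph T} (hP : P5Free B)
    (C : B.ConnectedComponent) {a b c d : T} (ha : a ∈ C.supp) (hac : a ≠ c) (hbd : b ≠ d)
    (hab : B.Adj a b) (hbc : B.Adj b c) (hcd : B.Adj c d) (hda : B.Adj d a) :
    C.supp = {a, b, c, d} := by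
  have h1 := hab.ne
  have h2 := hbc.ne
  have h3 := hcd.ne
  have h4 := hda.ne
  apply Set.Subset.antisymm
  · refine supp_subset_of_closed C _ ha (by simp) ?_
    intro u v hu huv
    by_contra hv
    simp only [Set.mem_insert_iff, Set.mem_singleton_iff, not_or] at hu hv
    obtain ⟨n1, n2, n3, n4⟩ := hv
    rcases hu with rfl | rfl | rfl | rfl
    · exact hP v u b c d (by simp; tauto) huv.symm hab hbc hcd
    · exact hP v u c d a (by simp; tauto) huv.symm hbc hcd hda
    · exact hP v u d a b (by simp; tauto) huv.symm hcd hda hab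
    · exact hP v u a b c (by simp; tauto) huv.symm hda hab hbc
  · have hb := (C.mem_supp_congr_adj hab).1 ha
    have hc := (C.mem_supp_congr_adj hbc).1 hb
    have hd := (C.mem_supp_congr_adj hcd).1 hc
    rintro u (rfl | rfl | rfl | rfl) <;> assumption

theorem neighbors_subset_supp {T : Type*} {B : SimpleGraph T} (C : B.ConnectedComponent)
    {u v : T} (hu : u ∈ C.supp) (h : B.Adj u v) : v ∈ C.supp :=
  (C.mem_supp_congr_adj h).1 hu

theorem degree_le_of_forall {T : Type*} [Fintype T] {B : SimpleGraph T} {u : T} (s : Finset T)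
    (h : ∀ v, B.Adj u v → v ∈ s) : B.degree u ≤ s.card := by
  rw [← B.card_neighborFinset_eq_degree]
  exact Finset.card_le_card fun v hv => h v ((B.mem_neighborFinset u v).1 hv)

/-- A component of a `P₅`-free graph containing a vertex of degree at least three but no
four-cycle is a double star or a star with at most one additional edge. -/
theorem sum_degree_le_of_no_four_cycle {T : Type*} [Fintype T] {B : SimpleGraph T}
    (hP : P5Free B) (C : B.ConnectedComponent)
    (hno : ∀ a b c d, a ∈ C.supp → a ≠ c → b ≠ d → B.Adj a b → B.Adj b c → B.Adj c d →
      B.Adj d a → False) :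
    ∑ u ∈ C.supp.toFinset, B.degree u ≤ 2 * C.supp.toFinset.card := by
  by_cases hdeg : ∀ u ∈ C.supp, B.degree u ≤ 2
  · calc ∑ u ∈ C.supp.toFinset, B.degree u ≤ ∑ u ∈ C.supp.toFinset, 2 :=
          Finset.sum_le_sum fun u hu => hdeg u (by simpa using hu)
      _ = _ := by simp [mul_comm]
  push Not at hdeg
  obtain ⟨v, hv, hvd⟩ := hdeg
  have third : ∀ a b, ∃ c, B.Adj v c ∧ c ≠ a ∧ c ≠ b := by
    intro a b
    by_contra hcon
    push Not at hcon
    have : B.degree v ≤ ({a, b} : Finset T).card := degree_le_of_forall _ fun c hc => by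
      by_cases h : c = a
      · simp [h]
      · simp [hcon c hc h]
    have := Finset.card_le_two (a := a) (b := b)
    omega
  by_cases hlev : ∃ a f, B.Adj v a ∧ B.Adj a f ∧ f ≠ v ∧ ¬ B.Adj v f
  · obtain ⟨a, f, hva, haf, hfv, hvf⟩ := hlev
    have haC := neighbors_subset_supp C hv hva
    have htri : ∀ b, B.Adj v b → ¬ B.Adj a b := by
      intro b hvb hab
      obtain ⟨c, hvc, hca, hcb⟩ := third a b
      have hfb : f ≠ b := by rintro rfl; exact hvf hvb
      have hfc : f ≠ c := by rintro rfl; exact hvf hvc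
      exact hP f a b v c (by simp [haf.ne', hfb, hfv, hfc, hab.ne, hva.ne', hca.symm, hvb.ne',
        hcb.symm, hvc.ne]) haf.symm hab hvb.symm hvc
    have hNv : ∀ b, B.Adj v b → b ≠ a → ∀ g, B.Adj b g → g = v := by
      intro b hvb hba g hbg
      by_contra hgv
      have hga : g ≠ a := by rintro rfl; exact htri b hvb hbg.symm
      have hgf : f ≠ g := by
        rintro rfl
        exact hno v a f b hv hfv.symm hba.symm hva haf hbg.symm hvb.symm
      have hfb : f ≠ b := by rintro rfl; exact hvf hvb
      exact hP f a v b g (by simp [haf.ne', hfv, hfb, hgf, hva.ne', hba.symm, hga.symm, hvb.ne,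
        Ne.symm hgv, hbg.ne]) haf.symm hva.symm hvb hbg
    have hNa : ∀ b, B.Adj a b → b ≠ v → ∀ g, B.Adj b g → g = a := by
      intro b hab hbv g hbg
      by_contra hga
      have hvb : ¬ B.Adj v b := fun h => htri b h hab
      have hgv : g ≠ v := by rintro rfl; exact hvb hbg.symm
      obtain ⟨c, hvc, hca, hcg⟩ := third a g
      have hbc : b ≠ c := by rintro rfl; exact hvb hvc
      exact hP g b a v c (by simp [hbg.ne', hga, hgv, hcg.symm, hab.ne', hbv, hbc, hva.ne',
        hca.symm, hvc.ne]) hbg.symm hab.symm hva.symm hvc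
    have hdisj : Disjoint (B.neighborFinset v) (B.neighborFinset a) := by
      rw [Finset.disjoint_left]
      intro b h1 h2
      rw [B.mem_neighborFinset] at h1 h2
      exact htri b h1 h2
    have hCe : C.supp.toFinset = B.neighborFinset v ∪ B.neighborFinset a := by
      ext u
      simp only [Set.mem_toFinset, Finset.mem_union, B.mem_neighborFinset]
      constructor
      · intro hu
        have := supp_subset_of_closed C {u | B.Adj v u ∨ B.Adj a u} hv (Or.inr hva.symm) ?_ hu
        · exact this
        · rintro b c (hb | hb) hbc
          · by_cases h : b = a
            · subst h; exact Or.inr hbc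
            · rw [hNv b hb h c hbc]; exact Or.inr hva.symm
          · by_cases h : b = v
            · subst h; exact Or.inl hbc
            · rw [hNa b hb h c hbc]; exact Or.inl hva
      · rintro (h | h)
        · exact neighbors_subset_supp C hv h
        · exact neighbors_subset_supp C haC h
    have hcard : C.supp.toFinset.card = B.degree v + B.degree a := by
      rw [hCe, Finset.card_union_of_disjoint hdisj, B.card_neighborFinset_eq_degree,
        B.card_neighborFinset_eq_degree]
    have hbound : ∀ u ∈ C.supp.toFinset, B.degree u ≤
        1 + ((if u = v then B.degree v - 1 else 0) + (if u = a then B.degree a - 1 else 0)) := by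
      intro u hu
      by_cases h1 : u = v
      · subst h1; simp [hva.ne]; omega
      by_cases h2 : u = a
      · subst h2; simp [h1]; omega
      simp only [h1, h2, if_false]
      rw [hCe, Finset.mem_union, B.mem_neighborFinset, B.mem_neighborFinset] at hu
      rcases hu with hu | hu
      · exact degree_le_of_forall {v} fun g hg => by simpa using hNv u hu h2 g hg
      · exact degree_le_of_forall {a} fun g hg => by simpa using hNa u hu h1 g hg
    have hda : 0 < B.degree a := (B.degree_pos_iff_exists_adj a).2 ⟨f, haf⟩
    refine (Finset.sum_le_sum hbound).trans ?_
    have hv' : v ∈ C.supp.toFinset := by simpa using hv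
    have ha' : a ∈ C.supp.toFinset := by simpa using haC
    rw [Finset.sum_add_distrib, Finset.sum_add_distrib, Finset.sum_ite_eq_of_mem' _ _ _ hv',
      Finset.sum_ite_eq_of_mem' _ _ _ ha']
    simp only [Finset.sum_const, smul_eq_mul, mul_one]
    omega
  · push Not at hlev
    have hCe : C.supp.toFinset = insert v (B.neighborFinset v) := by
      ext u
      simp only [Set.mem_toFinset, Finset.mem_insert, B.mem_neighborFinset]
      constructor
      · intro hu
        have := supp_subset_of_closed C {u | u = v ∨ B.Adj v u} hv (Or.inl rfl) ?_ hu
        · exact this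
        · rintro b c (rfl | hb) hbc
          · exact Or.inr hbc
          · by_cases h : c = v
            · exact Or.inl h
            · exact Or.inr (hlev b c hb hbc h)
      · rintro (rfl | h)
        · exact hv
        · exact neighbors_subset_supp C hv h
    have hcard : C.supp.toFinset.card = B.degree v + 1 := by
      rw [hCe, Finset.card_insert_of_notMem (by simp), B.card_neighborFinset_eq_degree]
    have huniq : ∀ a b c, B.Adj v a → B.Adj v b → B.Adj v c → B.Adj a b → B.Adj a c → b = c := by
      intro a b c ha hb hc hab hac
      by_contra hbc
      exact hno v b a c hv ha.ne hbc hb hab.symm hac hc.symm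
    obtain ⟨a, b, hbound⟩ : ∃ a b, ∀ u ∈ C.supp.toFinset, B.degree u ≤
        1 + ((if u = v then B.degree v - 1 else 0) + ((if u = a then 1 else 0) +
          (if u = b then 1 else 0))) := by
      by_cases hedge : ∃ a b, B.Adj v a ∧ B.Adj v b ∧ B.Adj a b
      · obtain ⟨a, b, ha, hb, hab⟩ := hedge
        refine ⟨a, b, fun u hu => ?_⟩
        by_cases h1 : u = v
        · subst h1; simp; omega
        have hvu : B.Adj v u := by
          rw [hCe, Finset.mem_insert, B.mem_neighborFinset] at hu
          tauto
        by_cases h2 : u = a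
        · subst h2
          have := degree_le_of_forall (B := B) (u := u) {v, b} fun g hg => by
            by_cases h : g = v
            · simp [h]
            · simp [huniq u b g hvu hb (hlev u g hvu hg h) hab hg]
          have h' := Finset.card_le_two (a := v) (b := b)
          simp only [h1, if_false, if_true]
          omega
        by_cases h3 : u = b
        · subst h3
          have := degree_le_of_forall (B := B) (u := u) {v, a} fun g hg => by
            by_cases h : g = v
            · simp [h]
            · simp [huniq u a g hvu ha (hlev u g hvu hg h) hab.symm hg]
          have h' := Finset.card_le_two (a := v) (b := a)
          simp only [h1, h2, if_false, if_true]
          omega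
        simp only [h1, h2, h3, if_false]
        refine degree_le_of_forall {v} fun g hg => ?_
        rw [Finset.mem_singleton]
        by_contra h
        have hvg := hlev u g hvu hg h
        by_cases hga : g = a
        · subst hga
          exact h3 (huniq g b u ha hb hvu hab hg.symm).symm
        by_cases hgb : g = b
        · subst hgb
          exact h2 (huniq g a u hb ha hvu hab.symm hg.symm).symm
        exact hP a b v u g (by simp [hab.ne, ha.ne', Ne.symm h2, Ne.symm hga, hb.ne', Ne.symm h3,
          Ne.symm hgb, Ne.symm h1, Ne.symm h, hg.ne]) hab hb.symm hvu hg
      · push Not at hedge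
        refine ⟨v, v, fun u hu => ?_⟩
        by_cases h1 : u = v
        · subst h1; simp; omega
        have hvu : B.Adj v u := by
          rw [hCe, Finset.mem_insert, B.mem_neighborFinset] at hu
          tauto
        simp only [h1, if_false]
        refine degree_le_of_forall {v} fun g hg => ?_
        rw [Finset.mem_singleton]
        by_contra h
        exact hedge u g hvu (hlev u g hvu hg h) hg
    refine (Finset.sum_le_sum hbound).trans ?_
    have hv' : v ∈ C.supp.toFinset := by simpa using hv
    rw [Finset.sum_add_distrib, Finset.sum_add_distrib, Finset.sum_add_distrib,
      Finset.sum_ite_eq_of_mem' _ _ _ hv', Finset.sum_ite_eq', Finset.sum_ite_eq']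
    simp only [Finset.sum_const, smul_eq_mul, mul_one]
    split_ifs <;> omega

/-- The components of a `P₅`-free graph have at most as many edges as vertices, except those
on four vertices that contain `K₄ - e`. -/
theorem sum_degree_le_or_isDiamond {T : Type*} [Fintype T] {B : SimpleGraph T}
    (hP : P5Free B) (C : B.ConnectedComponent) :
    ∑ u ∈ C.supp.toFinset, B.degree u ≤ 2 * C.supp.toFinset.card ∨
      ∃ p q r t, IsDiamond B p q r t ∧ C.supp.toFinset = {p, q, r, t} := by
  by_cases hno : ∀ a b c d, a ∈ C.supp → a ≠ c → b ≠ d → B.Adj a b → B.Adj b c → B.Adj c d →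
      B.Adj d a → False
  · exact Or.inl (sum_degree_le_of_no_four_cycle hP C hno)
  push Not at hno
  obtain ⟨a, b, c, d, ha, hac, hbd, hab, hbc, hcd, hda, -⟩ := hno
  have hC := supp_eq_of_four_cycle hP C ha hac hbd hab hbc hcd hda
  have hC' : C.supp.toFinset = {a, b, c, d} := by
    ext u; simp [hC]
  by_cases h1 : B.Adj a c
  · refine Or.inr ⟨a, c, b, d, ⟨h1, hab, hda.symm, hbc.symm, hcd, hbd⟩, ?_⟩
    rw [hC']; ext u; simp; tauto
  by_cases h2 : B.Adj b d
  · refine Or.inr ⟨b, d, a, c, ⟨h2, hab.symm, hbc, hda, hcd.symm, hac⟩, ?_⟩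
    rw [hC']; ext u; simp; tauto
  left
  refine (Finset.sum_le_card_nsmul _ _ 2 fun u hu => ?_).trans (by simp [mul_comm])
  have hu' : u ∈ C.supp := by simpa using hu
  have hcl : ∀ g, B.Adj u g → g = a ∨ g = b ∨ g = c ∨ g = d := fun g hg => by
    have := neighbors_subset_supp C hu' hg
    simpa [hC] using this
  rw [hC'] at hu
  simp only [Finset.mem_insert, Finset.mem_singleton] at hu
  rcases hu with rfl | rfl | rfl | rfl
  · refine (degree_le_of_forall {b, d} fun g hg => ?_).trans Finset.card_le_two
    rcases hcl g hg with rfl | rfl | rfl | rfl <;> simp_all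
  · refine (degree_le_of_forall {a, c} fun g hg => ?_).trans Finset.card_le_two
    rcases hcl g hg with rfl | rfl | rfl | rfl <;> simp_all
  · refine (degree_le_of_forall {b, d} fun g hg => ?_).trans Finset.card_le_two
    rcases hcl g hg with rfl | rfl | rfl | rfl <;> simp_all [B.adj_comm]
  · refine (degree_le_of_forall {a, c} fun g hg => ?_).trans Finset.card_le_two
    rcases hcl g hg with rfl | rfl | rfl | rfl <;> simp_all [B.adj_comm]

/-- The structure around a vertex `v` of largest Perron weight, normalised to one, of a graph
without `F₆`: `T` is the neighbourhood of `v`, `W` the set of vertices at distance at least two,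
`B` and `D` are the induced graphs, and `R` is the adjacency between `W` and `T`. -/
structure IsLocalSystem {T W : Type*} [Fintype T] [Fintype W] (B : SimpleGraph T)
    (D : SimpleGraph W) (R : W → T → Prop) (x : T → ℝ) (y : W → ℝ) (lam : ℝ) : Prop where
  x_nonneg : ∀ u, 0 ≤ x u
  x_le : ∀ u, x u ≤ 1
  y_le : ∀ w, y w ≤ 1
  sum_x : lam = ∑ u, x u
  eig_x : ∀ u, lam * x u = 1 + ∑ u' ∈ B.neighborFinset u, x u' + ∑ w with R w u, y w
  eig_y : ∀ w, lam * y w = ∑ u with R w u, x u + ∑ w' ∈ D.neighborFinset w, y w'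
  p5Free : P5Free B
  not_pq : ∀ w p q r t, IsDiamond B p q r t → R w p → ¬ R w q
  not_pr : ∀ w p q r t, IsDiamond B p q r t → R w p → ¬ R w r

/-- The contribution of a component to the upper bound for the number of edges in `W`. -/
noncomputable def excess {T : Type*} [Fintype T] (B : SimpleGraph T) (x : T → ℝ)
    (C : B.ConnectedComponent) : ℝ :=
  ∑ u ∈ C.supp.toFinset, (((B.degree u : ℝ) - 1) * x u - (B.degree u : ℝ) / 2)

theorem IsDiamond.swap_hubs {T : Type*} {B : SimpleGraph T} {p q r t : T}
    (h : IsDiamond B p q r t) : IsDiamond B q p r t :=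
  ⟨h.pq.symm, h.qr, h.qt, h.pr, h.pt, h.rt⟩

theorem IsDiamond.swap_ends {T : Type*} {B : SimpleGraph T} {p q r t : T}
    (h : IsDiamond B p q r t) : IsDiamond B p q t r :=
  ⟨h.pq, h.pt, h.pr, h.qt, h.qr, h.rt.symm⟩

theorem excess_nonpos {T : Type*} [Fintype T] {B : SimpleGraph T} {x : T → ℝ}
    (C : B.ConnectedComponent) (h0 : ∀ u, 0 ≤ x u) (h1 : ∀ u, x u ≤ 1)
    (hC : ∑ u ∈ C.supp.toFinset, B.degree u ≤ 2 * C.supp.toFinset.card) :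
    excess B x C ≤ 0 := by
  by_cases hiso : ∃ u ∈ C.supp, B.degree u = 0
  · obtain ⟨u, hu, hd⟩ := hiso
    have hsub := supp_subset_of_closed C {u} hu rfl (by
      rintro a b rfl hab
      have : 0 < B.degree a := (B.degree_pos_iff_exists_adj a).2 ⟨b, hab⟩
      omega)
    refine Finset.sum_nonpos fun v hv => ?_
    have hvu : v = u := hsub (by simpa using hv)
    rw [hvu, hd]
    have := h0 u
    norm_num
    linarith
  · push Not at hiso
    have hle : excess B x C ≤ ∑ u ∈ C.supp.toFinset, ((B.degree u : ℝ) / 2 - 1) := by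
      refine Finset.sum_le_sum fun u hu => ?_
      have hd : (1 : ℝ) ≤ B.degree u := by
        have := hiso u (by simpa using hu)
        exact_mod_cast Nat.one_le_iff_ne_zero.2 this
      nlinarith [h1 u]
    have hC' : (∑ u ∈ C.supp.toFinset, (B.degree u : ℝ)) ≤ 2 * C.supp.toFinset.card := by
      exact_mod_cast hC
    rw [Finset.sum_sub_distrib, ← Finset.sum_div] at hle
    simp only [Finset.sum_const, nsmul_eq_mul, mul_one] at hle
    linarith

theorem sum_four {T : Type*} {p q r t : T} (f : T → ℝ) (hpq : p ≠ q) (hpr : p ≠ r) (hpt : p ≠ t)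
    (hqr : q ≠ r) (hqt : q ≠ t) (hrt : r ≠ t) :
    ∑ u ∈ ({p, q, r, t} : Finset T), f u = f p + f q + f r + f t := by
  rw [Finset.sum_insert (by simp [*]), Finset.sum_insert (by simp [*]),
    Finset.sum_insert (by simp [*]), Finset.sum_singleton]
  ring

theorem IsLocalSystem.sum_four_mul_le {T W : Type*} [Fintype T] [Fintype W] {B : SimpleGraph T}
    {D : SimpleGraph W} {R : W → T → Prop} {x : T → ℝ} {y : W → ℝ} {lam : ℝ}
    (h : IsLocalSystem B D R x y lam) {p q r t : T} (c : ℝ) (s : Finset W)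
    (hd : ∀ u, u = p ∨ u = q ∨ u = r ∨ u = t → B.degree u ≤ 3)
    (hs : ∀ w ∉ s, ¬ R w p ∧ ¬ R w q ∧ ¬ R w r ∧ ¬ R w t)
    (hc : ∀ w ∈ s, (if R w p then (1 : ℝ) else 0) + (if R w q then 1 else 0) +
      (if R w r then 1 else 0) + (if R w t then 1 else 0) ≤ c) :
    lam * (x p + x q + x r + x t) ≤ 16 + c * s.card := by
  have hN : ∀ u, u = p ∨ u = q ∨ u = r ∨ u = t → ∑ u' ∈ B.neighborFinset u, x u' ≤ 3 := by
    intro u hu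
    have h1 : ∑ u' ∈ B.neighborFinset u, x u' ≤ ∑ u' ∈ B.neighborFinset u, (1 : ℝ) :=
      Finset.sum_le_sum fun u' _ => h.x_le u'
    have h2 : (B.degree u : ℝ) ≤ 3 := by exact_mod_cast hd u hu
    simp only [Finset.sum_const, nsmul_eq_mul, mul_one, B.card_neighborFinset_eq_degree] at h1
    linarith
  have hY : ∀ u, ∑ w with R w u, y w ≤ ∑ w, if R w u then (1 : ℝ) else 0 := by
    intro u
    rw [Finset.sum_filter]
    refine Finset.sum_le_sum fun w _ => ?_
    split_ifs
    · exact h.y_le w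
    · exact le_rfl
  have hsum : (∑ w, if R w p then (1 : ℝ) else 0) + (∑ w, if R w q then (1 : ℝ) else 0) +
      (∑ w, if R w r then (1 : ℝ) else 0) + (∑ w, if R w t then (1 : ℝ) else 0) ≤
      c * s.card := by
    rw [← Finset.sum_add_distrib, ← Finset.sum_add_distrib, ← Finset.sum_add_distrib,
      ← Finset.sum_subset (Finset.subset_univ s) (fun w _ hw => by simp [hs w hw])]
    refine (Finset.sum_le_sum hc).trans ?_
    simp [mul_comm]
  have e1 := h.eig_x p
  have e2 := h.eig_x q
  have e3 := h.eig_x r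
  have e4 := h.eig_x t
  have := hN p (by simp)
  have := hN q (by simp)
  have := hN r (by simp)
  have := hN t (by simp)
  have := hY p
  have := hY q
  have := hY r
  have := hY t
  linarith

theorem indicator_sum_le_two {P Q R S : Prop} (h1 : P → ¬ Q) (h2 : P → ¬ R) (h3 : P → ¬ S)
    (h4 : Q → ¬ R) (h5 : Q → ¬ S) :
    (if P then (1 : ℝ) else 0) + (if Q then 1 else 0) + (if R then 1 else 0) +
      (if S then 1 else 0) ≤ 2 := by
  split_ifs <;> first | (norm_num; done) | (exfalso; tauto)

theorem indicator_sum_le_one {P Q R S : Prop} (h1 : P → ¬ Q) (h2 : P → ¬ R) (h3 : P → ¬ S)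
    (h4 : Q → ¬ R) (h5 : Q → ¬ S) (h6 : R → ¬ S) :
    (if P then (1 : ℝ) else 0) + (if Q then 1 else 0) + (if R then 1 else 0) +
      (if S then 1 else 0) ≤ 1 := by
  split_ifs <;> first | (norm_num; done) | (exfalso; tauto)

theorem le_sum_indicator_compl {P Q R S : Prop} (h1 : P → ¬ Q) (h2 : P → ¬ R) (h3 : P → ¬ S)
    (h4 : Q → ¬ R) (h5 : Q → ¬ S) {a b c d m : ℝ} (hc : 0 ≤ c) (hd : 0 ≤ d)
    (m1 : m ≤ a + b) (m2 : m ≤ a + c + d) (m3 : m ≤ b + c + d) :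
    m ≤ (if P then 0 else a) + (if Q then 0 else b) + (if R then 0 else c) +
      (if S then 0 else d) := by
  split_ifs <;> first | linarith | (exfalso; tauto)

theorem le_sum_indicator_compl_of_pairwise {P Q R S : Prop} (h1 : P → ¬ Q) (h2 : P → ¬ R)
    (h3 : P → ¬ S) (h4 : Q → ¬ R) (h5 : Q → ¬ S) (h6 : R → ¬ S) {a b c d m : ℝ}
    (hd : 0 ≤ d) (m1 : m ≤ a + b + c) (m2 : m ≤ a + b + d)
    (m3 : m ≤ a + c + d) (m4 : m ≤ b + c + d) :
    m ≤ (if P then 0 else a) + (if Q then 0 else b) + (if R then 0 else c) +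
      (if S then 0 else d) := by
  split_ifs <;> first | linarith | (exfalso; tauto)

theorem IsLocalSystem.of_excess_pos {T W : Type*} [Fintype T] [Fintype W] {B : SimpleGraph T}
    {D : SimpleGraph W} {R : W → T → Prop} {x : T → ℝ} {y : W → ℝ} {lam : ℝ}
    (h : IsLocalSystem B D R x y lam) (hlam : 9.6 ≤ lam) (C : B.ConnectedComponent)
    (hC : 0 < excess B x C) :
    3 ≤ ∑ u ∈ C.supp.toFinset, x u ∧
      (∀ w, 1.5 ≤ ∑ u ∈ C.supp.toFinset, if R w u then 0 else x u) ∧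
      excess B x C * lam ≤ 1.5 * ({w | ∃ u ∈ C.supp, R w u} : Finset W).card := by
  rcases sum_degree_le_or_isDiamond h.p5Free C with hle | ⟨p, q, r, t, hd, hS⟩
  · exact absurd (excess_nonpos C h.x_nonneg h.x_le hle) (not_le.2 hC)
  have hmem : ∀ u, u ∈ C.supp ↔ u = p ∨ u = q ∨ u = r ∨ u = t := by
    intro u
    rw [← Set.mem_toFinset, hS]; simp
  have hNp : B.neighborFinset p = {q, r, t} := by
    ext g
    rw [B.mem_neighborFinset]
    constructor
    · intro hg
      have := (hmem g).1 (neighbors_subset_supp C ((hmem p).2 (by simp)) hg)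
      have := hg.ne'
      simp; tauto
    · simp only [Finset.mem_insert, Finset.mem_singleton]
      rintro (rfl | rfl | rfl)
      exacts [hd.pq, hd.pr, hd.pt]
  have hNq : B.neighborFinset q = {p, r, t} := by
    ext g
    rw [B.mem_neighborFinset]
    constructor
    · intro hg
      have := (hmem g).1 (neighbors_subset_supp C ((hmem q).2 (by simp)) hg)
      have := hg.ne'
      simp; tauto
    · simp only [Finset.mem_insert, Finset.mem_singleton]
      rintro (rfl | rfl | rfl)
      exacts [hd.pq.symm, hd.qr, hd.qt]
  have hdp : B.degree p = 3 := by
    rw [← B.card_neighborFinset_eq_degree, hNp]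
    exact Finset.card_eq_three.2 ⟨q, r, t, hd.qr.ne, hd.qt.ne, hd.rt, rfl⟩
  have hdq : B.degree q = 3 := by
    rw [← B.card_neighborFinset_eq_degree, hNq]
    exact Finset.card_eq_three.2 ⟨p, r, t, hd.pr.ne, hd.pt.ne, hd.rt, rfl⟩
  have hsum := fun f => sum_four f hd.pq.ne hd.pr.ne hd.pt.ne hd.qr.ne hd.qt.ne hd.rt
  have hp0 := h.x_nonneg p
  have hq0 := h.x_nonneg q
  have hr0 := h.x_nonneg r
  have ht0 := h.x_nonneg t
  have hp1 := h.x_le p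
  have hq1 := h.x_le q
  have hr1 := h.x_le r
  have ht1 := h.x_le t
  have hn : ∀ w ∉ ({w | ∃ u ∈ C.supp, R w u} : Finset W),
      ¬ R w p ∧ ¬ R w q ∧ ¬ R w r ∧ ¬ R w t := by
    intro w hw
    simp only [Finset.mem_filter, Finset.mem_univ, true_and, not_exists, not_and, hmem] at hw
    exact ⟨hw p (by simp), hw q (by simp), hw r (by simp), hw t (by simp)⟩
  have a1 := fun w => h.not_pq w _ _ _ _ hd
  have a2 := fun w => h.not_pr w _ _ _ _ hd
  have a3 := fun w => h.not_pr w _ _ _ _ hd.swap_ends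
  have a4 := fun w => h.not_pr w _ _ _ _ hd.swap_hubs
  have a5 := fun w => h.not_pr w _ _ _ _ hd.swap_hubs.swap_ends
  unfold excess at hC ⊢
  simp only [hS] at hC ⊢
  rw [hsum] at hC
  simp only [hsum]
  rw [hdp, hdq] at hC ⊢
  by_cases hrt : B.Adj r t
  · have hNr : B.neighborFinset r = {p, q, t} := by
      ext g
      rw [B.mem_neighborFinset]
      constructor
      · intro hg
        have := (hmem g).1 (neighbors_subset_supp C ((hmem r).2 (by simp)) hg)
        have := hg.ne'
        simp; tauto
      · simp only [Finset.mem_insert, Finset.mem_singleton]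
        rintro (rfl | rfl | rfl)
        exacts [hd.pr.symm, hd.qr.symm, hrt]
    have hNt : B.neighborFinset t = {p, q, r} := by
      ext g
      rw [B.mem_neighborFinset]
      constructor
      · intro hg
        have := (hmem g).1 (neighbors_subset_supp C ((hmem t).2 (by simp)) hg)
        have := hg.ne'
        simp; tauto
      · simp only [Finset.mem_insert, Finset.mem_singleton]
        rintro (rfl | rfl | rfl)
        exacts [hd.pt.symm, hd.qt.symm, hrt.symm]
    have hdr : B.degree r = 3 := by
      rw [← B.card_neighborFinset_eq_degree, hNr]
      exact Finset.card_eq_three.2 ⟨p, q, t, hd.pq.ne, hd.pt.ne, hd.qt.ne, rfl⟩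
    have hdt : B.degree t = 3 := by
      rw [← B.card_neighborFinset_eq_degree, hNt]
      exact Finset.card_eq_three.2 ⟨p, q, r, hd.pq.ne, hd.pr.ne, hd.qr.ne, rfl⟩
    have a6 := fun w => h.not_pq w _ _ _ _
      (⟨hrt, hd.pr.symm, hd.qr.symm, hd.pt.symm, hd.qt.symm, hd.pq.ne⟩ : IsDiamond B r t p q)
    have key := h.sum_four_mul_le 1 _
      (by rintro u (rfl | rfl | rfl | rfl) <;> omega) hn
      (fun w _ => indicator_sum_le_one (a1 w) (a2 w) (a3 w) (a4 w) (a5 w) (a6 w))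
    rw [hdr, hdt] at hC ⊢
    norm_num at hC
    refine ⟨by linarith, fun w => ?_, ?_⟩
    · norm_num
      exact le_sum_indicator_compl_of_pairwise (a1 w) (a2 w) (a3 w) (a4 w) (a5 w) (a6 w) ht0
        (by linarith) (by linarith) (by linarith) (by linarith)
    · norm_num at key ⊢
      nlinarith
  · have hNr : B.neighborFinset r = {p, q} := by
      ext g
      rw [B.mem_neighborFinset]
      constructor
      · intro hg
        have h1 := (hmem g).1 (neighbors_subset_supp C ((hmem r).2 (by simp)) hg)
        rcases h1 with rfl | rfl | rfl | rfl
        · simp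
        · simp
        · exact absurd rfl hg.ne
        · exact absurd hg hrt
      · simp only [Finset.mem_insert, Finset.mem_singleton]
        rintro (rfl | rfl)
        exacts [hd.pr.symm, hd.qr.symm]
    have hNt : B.neighborFinset t = {p, q} := by
      ext g
      rw [B.mem_neighborFinset]
      constructor
      · intro hg
        have h1 := (hmem g).1 (neighbors_subset_supp C ((hmem t).2 (by simp)) hg)
        rcases h1 with rfl | rfl | rfl | rfl
        · simp
        · simp
        · exact absurd hg.symm hrt
        · exact absurd rfl hg.ne
      · simp only [Finset.mem_insert, Finset.mem_singleton]
        rintro (rfl | rfl)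
        exacts [hd.pt.symm, hd.qt.symm]
    have hdr : B.degree r = 2 := by
      rw [← B.card_neighborFinset_eq_degree, hNr]
      exact Finset.card_pair hd.pq.ne
    have hdt : B.degree t = 2 := by
      rw [← B.card_neighborFinset_eq_degree, hNt]
      exact Finset.card_pair hd.pq.ne
    have key := h.sum_four_mul_le 2 _
      (by rintro u (rfl | rfl | rfl | rfl) <;> omega) hn
      (fun w _ => indicator_sum_le_two (a1 w) (a2 w) (a3 w) (a4 w) (a5 w))
    rw [hdr, hdt] at hC ⊢
    norm_num at hC
    refine ⟨by linarith, fun w => ?_, ?_⟩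
    · norm_num
      exact le_sum_indicator_compl (a1 w) (a2 w) (a3 w) (a4 w) (a5 w) hr0 ht0
        (by linarith) (by linarith) (by linarith)
    · norm_num at key ⊢
      nlinarith

theorem sum_sum_filter_comm {α β : Type*} [Fintype α] [Fintype β] (r : α → β → Prop)
    (f : β → ℝ) :
    ∑ a, ∑ b with r a b, f b = ∑ b, (({a | r a b} : Finset α).card : ℝ) * f b := by
  simp only [Finset.sum_filter]
  rw [Finset.sum_comm]
  refine Finset.sum_congr rfl fun b _ => ?_
  rw [← Finset.sum_filter, Finset.sum_const, nsmul_eq_mul]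

theorem two_mul_degree_le_sum_degree {W : Type*} [Fintype W] (D : SimpleGraph W) (w : W) :
    2 * D.degree w ≤ ∑ v, D.degree v := by
  have h1 : ∑ v ∈ insert w (D.neighborFinset w), D.degree v ≤ ∑ v, D.degree v :=
    Finset.sum_le_sum_of_subset (Finset.subset_univ _)
  rw [Finset.sum_insert (by simp)] at h1
  have h2 : (D.neighborFinset w).card • 1 ≤ ∑ v ∈ D.neighborFinset w, D.degree v :=
    Finset.card_nsmul_le_sum _ _ _ fun v hv =>
      (D.degree_pos_iff_exists_adj v).2 ⟨w, ((D.mem_neighborFinset w v).1 hv).symm⟩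
  rw [D.card_neighborFinset_eq_degree, smul_eq_mul, mul_one] at h2
  omega

theorem sum_supp {T : Type*} [Fintype T] (B : SimpleGraph T) (f : T → ℝ) :
    ∑ u, f u = ∑ C : B.ConnectedComponent, ∑ u ∈ C.supp.toFinset, f u := by
  rw [← Finset.sum_fiberwise (s := Finset.univ) (g := B.connectedComponentMk) (f := f)]
  refine Finset.sum_congr rfl fun C _ => Finset.sum_congr ?_ fun _ _ => rfl
  ext u
  simp [SimpleGraph.ConnectedComponent.mem_supp_iff]

theorem card_components_le {T : Type*} [Fintype T] {B : SimpleGraph T} (P : T → Prop)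
    (s : Finset B.ConnectedComponent) :
    (s.filter fun C => ∃ u ∈ C.supp, P u).card ≤ ({u | P u} : Finset T).card := by
  refine (Finset.card_le_card fun C hC => ?_).trans
    (Finset.card_image_le (s := ({u | P u} : Finset T)) (f := B.connectedComponentMk))
  obtain ⟨-, u, hu, hP⟩ := Finset.mem_filter.1 hC
  exact Finset.mem_image.2 ⟨u, by simpa using hP, hu⟩

theorem sum_card_filter_comm {α β : Type*} [Fintype α] (r : α → β → Prop) (s : Finset β) :
    ∑ a, ((s.filter (r a)).card : ℝ) = ∑ b ∈ s, (({a | r a b} : Finset α).card : ℝ) := by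
  simp only [Finset.card_filter, Nat.cast_sum]
  exact Finset.sum_comm

section

variable {T W : Type*} [Fintype T] [Fintype W] {B : SimpleGraph T} {D : SimpleGraph W}
  {R : W → T → Prop} {x : T → ℝ} {y : W → ℝ} {lam : ℝ}

theorem IsLocalSystem.sq_eq (h : IsLocalSystem B D R x y lam) :
    lam ^ 2 = Fintype.card T + ∑ u, (B.degree u : ℝ) * x u +
      ∑ w, (({u | R w u} : Finset T).card : ℝ) * y w := by
  have h1 : lam ^ 2 = ∑ u, lam * x u := by
    rw [← Finset.mul_sum, ← h.sum_x, sq]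
  rw [h1, Finset.sum_congr rfl fun u _ => h.eig_x u, Finset.sum_add_distrib,
    Finset.sum_add_distrib]
  congr 1
  · congr 1
    · simp
    · simp only [SimpleGraph.neighborFinset_eq_filter]
      rw [sum_sum_filter_comm]
      refine Finset.sum_congr rfl fun u _ => ?_
      rw [← B.card_neighborFinset_eq_degree, SimpleGraph.neighborFinset_eq_filter]
      simp only [B.adj_comm]
  · rw [sum_sum_filter_comm (fun u w => R w u)]

theorem IsLocalSystem.edge_bound (h : IsLocalSystem B D R x y lam) {m : ℝ}
    (hm : 2 * m = 2 * Fintype.card T + ∑ u, (B.degree u : ℝ) +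
      2 * ∑ w, (({u | R w u} : Finset T).card : ℝ) + ∑ w, (D.degree w : ℝ))
    (hml : m - 1 ≤ lam ^ 2 - lam) :
    (∑ w, (D.degree w : ℝ)) / 2 + ∑ w, (({u | R w u} : Finset T).card : ℝ) * (1 - y w) ≤
      1 + ∑ C : B.ConnectedComponent, excess B x C := by
  have h1 := h.sq_eq
  have h2 : ∑ C : B.ConnectedComponent, excess B x C =
      ∑ u, (B.degree u : ℝ) * x u - ∑ u, x u - (∑ u, (B.degree u : ℝ)) / 2 := by
    unfold excess
    rw [← sum_supp, Finset.sum_div, ← Finset.sum_sub_distrib, ← Finset.sum_sub_distrib]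
    exact Finset.sum_congr rfl fun u _ => by ring
  have h3 : ∑ w, (({u | R w u} : Finset T).card : ℝ) * (1 - y w) =
      ∑ w, (({u | R w u} : Finset T).card : ℝ)
        - ∑ w, (({u | R w u} : Finset T).card : ℝ) * y w := by
    rw [← Finset.sum_sub_distrib]
    exact Finset.sum_congr rfl fun w _ => by ring
  rw [h2, h3, ← h.sum_x]
  linarith

theorem IsLocalSystem.le_mul_one_sub (h : IsLocalSystem B D R x y lam) (w : W)
    (s : Finset B.ConnectedComponent) :
    ∑ C ∈ s, (∑ u ∈ C.supp.toFinset, if R w u then 0 else x u) - D.degree w ≤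
      lam * (1 - y w) := by
  have h1 : ∑ C ∈ s, (∑ u ∈ C.supp.toFinset, if R w u then 0 else x u) ≤
      ∑ u, if R w u then 0 else x u := by
    rw [sum_supp B]
    refine Finset.sum_le_sum_of_subset_of_nonneg (Finset.subset_univ s) fun C _ _ =>
      Finset.sum_nonneg fun u _ => ?_
    split_ifs
    exacts [le_rfl, h.x_nonneg u]
  have h2 : lam = ∑ u with R w u, x u + ∑ u, if R w u then 0 else x u := by
    rw [h.sum_x, Finset.sum_filter, ← Finset.sum_add_distrib]
    exact Finset.sum_congr rfl fun u _ => by split_ifs <;> simp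
  have h3 : ∑ w' ∈ D.neighborFinset w, y w' ≤ D.degree w := by
    rw [← D.card_neighborFinset_eq_degree]
    simpa using Finset.sum_le_sum fun w' (_ : w' ∈ D.neighborFinset w) => h.y_le w'
  have h4 := h.eig_y w
  linarith

/-- The loss at the vertices of `W` compensates for the components of positive excess. -/
theorem IsLocalSystem.excess_le_loss (h : IsLocalSystem B D R x y lam) (hlam : 9.6 ≤ lam)
    (s : Finset B.ConnectedComponent) (hs : ∀ C ∈ s, 0 < excess B x C) :
    lam * ∑ C ∈ s, excess B x C - s.card * ∑ w, (D.degree w : ℝ) ≤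
      lam * ∑ w, (({u | R w u} : Finset T).card : ℝ) * (1 - y w) := by
  obtain ⟨t, ht⟩ : ∃ t : W → ℝ, ∀ w,
      t w = ((s.filter fun C => ∃ u ∈ C.supp, R w u).card : ℝ) := ⟨_, fun _ => rfl⟩
  set k : ℝ := (s.card : ℝ) with hk
  have hk0 : 0 ≤ k := Nat.cast_nonneg _
  have htk : ∀ w, t w ≤ k := fun w => by
    rw [ht]
    exact Nat.cast_le.2 (Finset.card_filter_le s _)
  have hloss : ∀ w, t w * (1.5 * k) - k * D.degree w ≤
      lam * ((({u | R w u} : Finset T).card : ℝ) * (1 - y w)) := by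
    intro w
    have h1 := h.le_mul_one_sub w s
    have h2 : s.card • (1.5 : ℝ) ≤
        ∑ C ∈ s, (∑ u ∈ C.supp.toFinset, if R w u then 0 else x u) :=
      Finset.card_nsmul_le_sum _ _ _ fun C hC => (h.of_excess_pos hlam C (hs C hC)).2.1 w
    rw [nsmul_eq_mul] at h2
    have h3 : t w ≤ (({u | R w u} : Finset T).card : ℝ) := by
      rw [ht]
      exact Nat.cast_le.2 (card_components_le (R w) s)
    have h4 : 0 ≤ t w := by
      rw [ht]
      exact Nat.cast_nonneg _
    have h5 : (0 : ℝ) ≤ D.degree w := Nat.cast_nonneg _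
    have h6 : 0 ≤ lam * (1 - y w) := mul_nonneg (by linarith) (by linarith [h.y_le w])
    have h7 := mul_le_mul_of_nonneg_right h3 h6
    have h8 : 1.5 * k - D.degree w ≤ lam * (1 - y w) := by linarith
    have h9 := mul_le_mul_of_nonneg_left h8 h4
    have h10 := mul_le_mul_of_nonneg_right (htk w) h5
    nlinarith
  have hcount : ∑ w, t w =
      ∑ C ∈ s, (({w | ∃ u ∈ C.supp, R w u} : Finset W).card : ℝ) := by
    simp only [ht]
    convert sum_card_filter_comm (fun w (C : B.ConnectedComponent) => ∃ u ∈ C.supp, R w u) s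
  have hbad : (∑ C ∈ s, excess B x C) * lam ≤ 1.5 * ∑ w, t w := by
    rw [hcount, Finset.sum_mul, Finset.mul_sum]
    exact Finset.sum_le_sum fun C hC => (h.of_excess_pos hlam C (hs C hC)).2.2
  have hpos : 0 ≤ ∑ C ∈ s, excess B x C := Finset.sum_nonneg fun C hC => (hs C hC).le
  have hself : (∑ C ∈ s, excess B x C) * lam ≤ k * ((∑ C ∈ s, excess B x C) * lam) := by
    rcases s.eq_empty_or_nonempty with rfl | hne
    · simp
    · have : (1 : ℝ) ≤ k := Nat.one_le_cast.2 hne.card_pos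
      have := mul_nonneg hpos (show 0 ≤ lam by linarith)
      nlinarith
  have hsum := Finset.sum_le_sum fun w (_ : w ∈ Finset.univ) => hloss w
  rw [Finset.sum_sub_distrib, ← Finset.sum_mul, ← Finset.mul_sum, ← Finset.mul_sum] at hsum
  have := mul_le_mul_of_nonneg_left hbad hk0
  linarith

theorem IsLocalSystem.three_mul_card_le (h : IsLocalSystem B D R x y lam) (hlam : 9.6 ≤ lam)
    (s : Finset B.ConnectedComponent) (hs : ∀ C ∈ s, 0 < excess B x C) :
    3 * (s.card : ℝ) ≤ lam := by
  have h1 : s.card • (3 : ℝ) ≤ ∑ C ∈ s, ∑ u ∈ C.supp.toFinset, x u :=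
    Finset.card_nsmul_le_sum _ _ _ fun C hC => (h.of_excess_pos hlam C (hs C hC)).1
  have h2 : ∑ C ∈ s, ∑ u ∈ C.supp.toFinset, x u ≤ ∑ u, x u := by
    rw [sum_supp B]
    exact Finset.sum_le_sum_of_subset_of_nonneg (Finset.subset_univ s) fun C _ _ =>
      Finset.sum_nonneg fun u _ => h.x_nonneg u
  rw [h.sum_x]
  rw [nsmul_eq_mul] at h1
  linarith

theorem IsLocalSystem.mul_le_sub_one (h : IsLocalSystem B D R x y lam) (hlam : 9.6 ≤ lam) {m : ℝ}
    (hm : 2 * m = 2 * Fintype.card T + ∑ u, (B.degree u : ℝ) +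
      2 * ∑ w, (({u | R w u} : Finset T).card : ℝ) + ∑ w, (D.degree w : ℝ))
    (hml : m - 1 ≤ lam ^ 2 - lam) (C : B.ConnectedComponent) (hcard : C.supp.ncard = 4)
    (hdeg : ∀ u ∈ C.supp, B.degree u = 2) (w : W)
    (hw : {u ∈ C.supp | R w u}.ncard ≤ 2) :
    lam * y w ≤ lam - 1 := by
  rw [Set.ncard_eq_toFinset_card'] at hcard
  have hexC : excess B x C = ∑ u ∈ C.supp.toFinset, x u - 4 := by
    unfold excess
    rw [Finset.sum_congr rfl fun u hu => by rw [hdeg u (by simpa using hu)],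
      Finset.sum_sub_distrib, Finset.sum_const, hcard]
    norm_num
  have hx4 : ∑ u ∈ C.supp.toFinset, x u ≤ 4 := by
    simpa [hcard] using Finset.sum_le_sum fun u (_ : u ∈ C.supp.toFinset) => h.x_le u
  set s : Finset B.ConnectedComponent := {C' | 0 < excess B x C'} with hs
  have hs' : ∀ C' ∈ s, 0 < excess B x C' := fun C' hC' => (Finset.mem_filter.1 hC').2
  have hCs : C ∉ s := fun hC => by
    have := hs' C hC
    linarith
  have hsplit : ∑ C', excess B x C' ≤ excess B x C + ∑ C' ∈ s, excess B x C' := by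
    rw [← Finset.sum_insert hCs, ← Finset.sum_add_sum_compl (insert C s)]
    have : ∑ C' ∈ (insert C s)ᶜ, excess B x C' ≤ 0 := Finset.sum_nonpos fun C' hC' => by
      simp only [Finset.mem_compl, Finset.mem_insert, not_or, hs, Finset.mem_filter,
        Finset.mem_univ, true_and, not_lt] at hC'
      exact hC'.2
    linarith
  have hnon : ∑ u ∈ C.supp.toFinset, x u - 2 ≤
      ∑ u ∈ C.supp.toFinset, if R w u then 0 else x u := by
    have h1 : ∑ u ∈ C.supp.toFinset, x u = ∑ u ∈ C.supp.toFinset.filter (R w), x u +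
        ∑ u ∈ C.supp.toFinset, if R w u then 0 else x u := by
      rw [Finset.sum_filter, ← Finset.sum_add_distrib]
      exact Finset.sum_congr rfl fun u _ => by split_ifs <;> simp
    have h2 : ∑ u ∈ C.supp.toFinset.filter (R w), x u ≤ (C.supp.toFinset.filter (R w)).card := by
      simpa using Finset.sum_le_sum fun u (_ : u ∈ C.supp.toFinset.filter (R w)) => h.x_le u
    have h3 : ((C.supp.toFinset.filter (R w)).card : ℝ) ≤ 2 := by
      rw [← Set.ncard_coe_finset, Finset.coe_filter]
      simp only [Set.mem_toFinset]
      exact_mod_cast hw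
    linarith
  have hbad : 1.5 * (s.card : ℝ) ≤
      ∑ C' ∈ s, (∑ u ∈ C'.supp.toFinset, if R w u then 0 else x u) := by
    have : s.card • (1.5 : ℝ) ≤ _ := Finset.card_nsmul_le_sum s
      (fun C' => ∑ u ∈ C'.supp.toFinset, if R w u then 0 else x u) _
      fun C' hC' => (h.of_excess_pos hlam C' (hs' C' hC')).2.1 w
    rw [nsmul_eq_mul] at this
    linarith
  have hgap := h.le_mul_one_sub w (insert C s)
  rw [Finset.sum_insert hCs] at hgap
  have hdw : 2 * (D.degree w : ℝ) ≤ ∑ v, (D.degree v : ℝ) := by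
    exact_mod_cast two_mul_degree_le_sum_degree D w
  have hedge := h.edge_bound hm hml
  have hloss := h.excess_le_loss hlam s hs'
  have hk := h.three_mul_card_le hlam s hs'
  have hk0 : (0 : ℝ) ≤ s.card := Nat.cast_nonneg _
  set E := (∑ v, (D.degree v : ℝ)) / 2 with hE
  have hE0 : 0 ≤ E := by
    have : (0 : ℝ) ≤ D.degree w := Nat.cast_nonneg _
    linarith
  have hmain : (lam - 2 * s.card) * E ≤ lam * (∑ u ∈ C.supp.toFinset, x u - 3) := by
    have := mul_le_mul_of_nonneg_left (hedge.trans (add_le_add_right hsplit 1))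
      (show 0 ≤ lam by linarith)
    rw [hexC] at this
    have hEE : ∑ v, (D.degree v : ℝ) = 2 * E := by rw [hE]; ring
    rw [hEE] at hloss
    linarith
  have hE3 : E ≤ 3 := by nlinarith
  have : E ≤ 1.5 * s.card + (∑ u ∈ C.supp.toFinset, x u - 3) := by
    have hpos : 0 < lam := by linarith
    have : lam * E ≤ lam * (1.5 * s.card + (∑ u ∈ C.supp.toFinset, x u - 3)) := by
      nlinarith
    exact le_of_mul_le_mul_left this hpos
  linarith

end

theorem F6Free.not_path {V : Type*} {G : SimpleGraph V} (hG : F6Free G) {v a b c d e : V}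
    (hn : [a, b, c, d, e].Nodup) (hab : G.Adj a b) (hbc : G.Adj b c) (hcd : G.Adj c d)
    (hde : G.Adj d e) (ha : G.Adj v a) (hb : G.Adj v b) (hc : G.Adj v c) (hd : G.Adj v d)
    (he : G.Adj v e) : False := by
  refine hG ⟨⟨![a, b, c, d, e, v], ?_⟩, ?_⟩
  · intro i j hij
    rw [fan6, SimpleGraph.fromRel_adj] at hij
    fin_cases i <;> fin_cases j <;>
      first
        | (simp at hij; done)
        | assumption
        | (apply SimpleGraph.Adj.symm; assumption)
  · have := ha.ne
    have := hb.ne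
    have := hc.ne
    have := hd.ne
    have := he.ne
    have hn' : [a, b, c, d, e, v].Nodup := by
      simp only [List.nodup_cons, List.mem_cons, List.not_mem_nil, or_false, not_or] at hn ⊢
      tauto
    have h : (List.ofFn ![a, b, c, d, e, v]).Nodup := by
      simpa [List.ofFn_succ] using hn'
    exact List.nodup_ofFn.1 h

section

variable {V : Type*} [Fintype V] (G : SimpleGraph V) (v : V)

theorem sum_split_neighborhood (f : V → ℝ) :
    ∑ a, f a = f v + ∑ u : G.neighborSet v, f u +
      ∑ w : ((insert v (G.neighborSet v))ᶜ : Set V), f w := by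
  have h1 := Finset.sum_add_sum_compl (insert v (G.neighborFinset v)) f
  rw [← h1, Finset.sum_insert (by simp)]
  congr 1
  · congr 1
    exact Finset.sum_subtype _ (fun u => by simp) f
  · exact Finset.sum_subtype _ (fun u => by simp) f

theorem sum_adj_center (f : V → ℝ) :
    ∑ b, (if G.Adj v b then f b else 0) = ∑ u : G.neighborSet v, f u := by
  rw [sum_split_neighborhood G v, if_neg (G.loopless.irrefl v), zero_add,
    Finset.sum_congr rfl fun (u : G.neighborSet v) _ => if_pos (show G.Adj v u from u.2),
    add_eq_left]
  exact Finset.sum_eq_zero fun w _ => if_neg fun h => w.2 (Or.inr h)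

theorem sum_adj_neighbor (f : V → ℝ) (u : G.neighborSet v) :
    ∑ b, (if G.Adj u b then f b else 0) = f v +
      ∑ u' ∈ (G.induce (G.neighborSet v)).neighborFinset u, f u' +
      ∑ w with G.Adj (w : ((insert v (G.neighborSet v))ᶜ : Set V)) u, f w := by
  have hu : G.Adj u v := G.adj_symm u.2
  rw [sum_split_neighborhood G v, if_pos hu, SimpleGraph.neighborFinset_eq_filter,
    Finset.sum_filter, Finset.sum_filter]
  congr 1
  exact Finset.sum_congr rfl fun w _ => by rw [G.adj_comm]

theorem sum_adj_far (f : V → ℝ) (w : ((insert v (G.neighborSet v))ᶜ : Set V)) :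
    ∑ b, (if G.Adj w b then f b else 0) =
      ∑ u with G.Adj w (u : G.neighborSet v), f u +
      ∑ w' ∈ (G.induce (insert v (G.neighborSet v))ᶜ).neighborFinset w, f w' := by
  have hw : ¬ G.Adj w v := fun h => w.2 (Or.inr h.symm)
  rw [sum_split_neighborhood G v, if_neg hw, zero_add, SimpleGraph.neighborFinset_eq_filter,
    Finset.sum_filter, Finset.sum_filter]
  rfl

theorem two_mul_edges_eq {m : ℕ} (hm : G.edgeSet.ncard = m) :
    2 * (m : ℝ) = 2 * Fintype.card (G.neighborSet v) +
      ∑ u, ((G.induce (G.neighborSet v)).degree u : ℝ) +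
      2 * ∑ w : ((insert v (G.neighborSet v))ᶜ : Set V),
        (({u | G.Adj w u} : Finset (G.neighborSet v)).card : ℝ) +
      ∑ w, ((G.induce (insert v (G.neighborSet v))ᶜ).degree w : ℝ) := by
  have h1 : 2 * (m : ℝ) = ∑ a, ∑ b, (if G.Adj a b then (1 : ℝ) else 0) := by
    have h2 := G.sum_degrees_eq_twice_card_edges
    rw [← Set.ncard_coe_finset, SimpleGraph.coe_edgeFinset, hm] at h2
    have h3 : (∑ a, (G.degree a : ℝ)) = 2 * m := by exact_mod_cast h2
    rw [← h3]
    refine Finset.sum_congr rfl fun a _ => ?_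
    rw [← G.card_neighborFinset_eq_degree, SimpleGraph.neighborFinset_eq_filter]
    simp
  have hcomm := sum_sum_filter_comm
    (fun (u : G.neighborSet v) (w : ((insert v (G.neighborSet v))ᶜ : Set V)) => G.Adj w u)
    (fun _ => 1)
  rw [h1, sum_split_neighborhood G v, sum_adj_center G v (fun _ => 1),
    Finset.sum_congr rfl fun u _ => sum_adj_neighbor G v (fun _ => 1) u,
    Finset.sum_congr rfl fun w _ => sum_adj_far G v (fun _ => 1) w,
    Finset.sum_add_distrib, Finset.sum_add_distrib, Finset.sum_add_distrib, hcomm]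
  simp only [Finset.sum_const, nsmul_eq_mul, mul_one, SimpleGraph.card_neighborFinset_eq_degree,
    Finset.card_univ]
  ring

variable {G v}

theorem isLocalSystem_of_eigenvector (hG : F6Free G) {lam : ℝ} {x : V → ℝ}
    (hx : ∀ a, 0 < x a) (hv : ∀ a, x a ≤ x v)
    (heig : ∀ a, lam * x a = ∑ b, if G.Adj a b then x b else 0) :
    IsLocalSystem (G.induce (G.neighborSet v)) (G.induce (insert v (G.neighborSet v))ᶜ)
      (fun w u => G.Adj w u) (fun u => x u / x v) (fun w => x w / x v) lam where
  x_nonneg u := (div_pos (hx u) (hx v)).le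
  x_le u := (div_le_one (hx v)).2 (hv u)
  y_le w := (div_le_one (hx v)).2 (hv w)
  sum_x := by
    rw [← Finset.sum_div, ← sum_adj_center G v, ← heig, mul_div_assoc, div_self (hx v).ne',
      mul_one]
  eig_x u := by
    rw [← mul_div_assoc, heig, sum_adj_neighbor, add_div, add_div, div_self (hx v).ne',
      Finset.sum_div, Finset.sum_div]
    rfl
  eig_y w := by
    rw [← mul_div_assoc, heig, sum_adj_far, add_div, Finset.sum_div, Finset.sum_div]
    rfl
  p5Free a b c d e hn hab hbc hcd hde := by
    refine hG.not_path (v := v) (a := a) (b := b) (c := c) (d := d) (e := e) ?_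
      hab hbc hcd hde a.2 b.2 c.2 d.2 e.2
    simpa using hn.map Subtype.val_injective
  not_pq w p q r t hd hp hq := by
    have hw : ∀ u : G.neighborSet v, (w : V) ≠ u := fun u h => w.2 (Or.inr (h ▸ u.2))
    have hwv : (w : V) ≠ v := fun h => w.2 (Or.inl h)
    have hrt : (r : V) ≠ t := fun h => hd.rt (Subtype.ext h)
    have hqr : G.Adj q r := hd.qr
    have hqt : G.Adj q t := hd.qt
    refine hG.not_path (v := p) (a := w) (b := q) (c := r) (d := v) (e := t) ?_
      hq hqr (G.adj_symm r.2) t.2 hp.symm hd.pq hd.pr (G.adj_symm p.2) hd.pt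
    have h1 := G.ne_of_adj q.2
    have h2 := G.ne_of_adj r.2
    have h3 := G.ne_of_adj t.2
    simp [hw, hwv, hrt, hqr.ne, hqt.ne, h1.symm, h2.symm, h3]
  not_pr w p q r t hd hp hr := by
    have hw : ∀ u : G.neighborSet v, (w : V) ≠ u := fun u h => w.2 (Or.inr (h ▸ u.2))
    have hwv : (w : V) ≠ v := fun h => w.2 (Or.inl h)
    have hrt : (r : V) ≠ t := fun h => hd.rt (Subtype.ext h)
    have hqr : G.Adj q r := hd.qr
    have hqt : G.Adj q t := hd.qt
    refine hG.not_path (v := p) (a := w) (b := r) (c := q) (d := t) (e := v) ?_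
      hr hqr.symm hqt (G.adj_symm t.2) hp.symm hd.pr hd.pq hd.pt (G.adj_symm p.2)
    have h1 := G.ne_of_adj q.2
    have h2 := G.ne_of_adj r.2
    have h3 := G.ne_of_adj t.2
    simp [hw, hwv, hrt, hqr.ne', hqt.ne, h1.symm, h2.symm, h3.symm]

end

/-- A component isomorphic to a four-cycle has four vertices, all of degree two. -/
theorem card_and_degree_of_four_cycle {V : Type*} [Fintype V] {G : SimpleGraph V} {S : Set V}
    (C : (G.induce S).ConnectedComponent)
    (hC : Nonempty ((G.induce (Subtype.val '' C.supp)) ≃g SimpleGraph.cycleGraph 4)) :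
    C.supp.ncard = 4 ∧ ∀ u ∈ C.supp, (G.induce S).degree u = 2 := by
  obtain ⟨φ⟩ := hC
  have hmem : ∀ i, ∃ u : S, u ∈ C.supp ∧ (u : V) = φ.symm i := fun i => (φ.symm i).2
  choose g hgC hg using hmem
  have hinj : Function.Injective g := fun i j hij => by
    apply φ.symm.injective
    apply Subtype.ext
    rw [← hg, ← hg, hij]
  have hsurj : ∀ u ∈ C.supp, ∃ i, g i = u := fun u hu => by
    refine ⟨φ ⟨u, u, hu, rfl⟩, Subtype.ext ?_⟩
    rw [hg, φ.symm_apply_apply]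
  have hadj : ∀ i j, (G.induce S).Adj (g i) (g j) ↔ (SimpleGraph.cycleGraph 4).Adj i j := by
    intro i j
    rw [← φ.symm.map_adj_iff, SimpleGraph.comap_adj, SimpleGraph.comap_adj]
    simp [hg]
  constructor
  · have : C.supp = g '' Set.univ := by
      ext u
      simp only [Set.mem_image, Set.mem_univ, true_and]
      exact ⟨hsurj u, by rintro ⟨i, rfl⟩; exact hgC i⟩
    rw [this, Set.ncard_image_of_injective _ hinj]
    simp
  · intro u hu
    obtain ⟨i, rfl⟩ := hsurj u hu
    have : (G.induce S).neighborFinset (g i) =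
        ((SimpleGraph.cycleGraph 4).neighborFinset i).image g := by
      ext u
      simp only [SimpleGraph.mem_neighborFinset, Finset.mem_image]
      constructor
      · intro h
        obtain ⟨j, rfl⟩ := hsurj u (neighbors_subset_supp C hu h)
        exact ⟨j, (hadj i j).1 h, rfl⟩
      · rintro ⟨j, hj, rfl⟩
        exact (hadj i j).2 hj
    rw [← SimpleGraph.card_neighborFinset_eq_degree, this,
      Finset.card_image_of_injective _ hinj, SimpleGraph.card_neighborFinset_eq_degree]
    convert SimpleGraph.cycleGraph_degree_three_le (n := 1) (v := i)

theorem F6Free.mul_le_of_four_cycle {V : Type*} [Fintype V] {G : SimpleGraph V} (hG : F6Free G)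
    {v : V} {lam : ℝ} {x : V → ℝ} (hx : ∀ a, 0 < x a) (hv : ∀ a, x a ≤ x v)
    (heig : ∀ a, lam * x a = ∑ b, if G.Adj a b then x b else 0) (hlam : 9.6 ≤ lam)
    (hml : (G.edgeSet.ncard : ℝ) - 1 ≤ lam ^ 2 - lam)
    (C : (G.induce (G.neighborSet v)).ConnectedComponent)
    (hC : Nonempty ((G.induce (Subtype.val '' C.supp)) ≃g SimpleGraph.cycleGraph 4))
    (w : ((insert v (G.neighborSet v))ᶜ : Set V))
    (hw : {u ∈ Subtype.val '' C.supp | G.Adj w u}.ncard ≤ 2) :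
    lam * x w ≤ (lam - 1) * x v := by
  obtain ⟨hcard, hdeg⟩ := card_and_degree_of_four_cycle C hC
  have hR : {u ∈ C.supp | G.Adj w u}.ncard ≤ 2 := by
    refine le_trans (le_of_eq ?_) hw
    rw [← Set.ncard_image_of_injective _ Subtype.val_injective]
    congr 1
    ext a
    constructor
    · rintro ⟨u, ⟨hu, hR⟩, rfl⟩
      exact ⟨⟨u, hu, rfl⟩, hR⟩
    · rintro ⟨⟨u, hu, rfl⟩, hR⟩
      exact ⟨u, ⟨hu, hR⟩, rfl⟩
  have hle := (isLocalSystem_of_eigenvector hG hx hv heig).mul_le_sub_one hlam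
    (two_mul_edges_eq G v rfl) hml C hcard hdeg w hR
  rwa [← mul_div_assoc, div_le_iff₀ (hx v)] at hle

theorem stmt_18 
    {V : Type} [Fintype V] [DecidableEq V] (G : SimpleGraph V) [DecidableRel G.Adj]
    (m : ℕ) (hm : 88 ≤ m)
    (hfree : F6Free G)
    (hcard : G.edgeSet.ncard = m)
    (hnoiso : ∀ v : V, ∃ w, G.Adj v w)
    (hmax : ∀ (n : ℕ) (G' : SimpleGraph (Fin n)), F6Free G' → G'.edgeSet.ncard = m →
      (∀ v, ∃ w, G'.Adj v w) → specRad G' ≤ specRad G)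
    (lam : ℝ) (hlam : lam = specRad G)
    (hconn : G.Connected)
    (hlow : (1 + Real.sqrt (4 * (m : ℝ) - 3)) / 2 ≤ lam)
    (x : V → ℝ) (hxpos : ∀ v, 0 < x v)
    (heig : (G.adjMatrix ℝ).mulVec x = lam • x)
    (ustar : V) (hustar : ∀ v, x v ≤ x ustar)
   
    (C : (G.induce (G.neighborSet ustar)).ConnectedComponent)
    (hC4 : Nonempty ((G.induce (Subtype.val '' C.supp)) ≃g SimpleGraph.cycleGraph 4)) :
    ∀ w ∈ (insert ustar (G.neighborSet ustar))ᶜ,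
      {v ∈ (Subtype.val '' C.supp) | G.Adj w v}.ncard ≤ 2 →
        x w ≤ (lam - 1) / lam * x ustar := by

  intro w hw hcount
  have hm' : (88 : ℝ) ≤ m := by exact_mod_cast hm
  have hsqrt : (18.2 : ℝ) ≤ Real.sqrt (4 * (m : ℝ) - 3) :=
    Real.le_sqrt_of_sq_le (by norm_num; linarith)
  have hsq := Real.sq_sqrt (show 0 ≤ 4 * (m : ℝ) - 3 by linarith)
  have hlam96 : 9.6 ≤ lam := by norm_num at hsqrt ⊢; linarith
  have hml : (G.edgeSet.ncard : ℝ) - 1 ≤ lam ^ 2 - lam := by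
    rw [hcard]
    nlinarith
  have hle := hfree.mul_le_of_four_cycle hxpos hustar (fun a => by
      have := congrFun heig a
      rw [Pi.smul_apply, smul_eq_mul] at this
      rw [← this]
      simp only [Matrix.mulVec, dotProduct, SimpleGraph.adjMatrix_apply, ite_mul, one_mul,
        zero_mul]
      exact Finset.sum_congr rfl fun b _ => by congr)
    hlam96 hml C hC4 ⟨w, hw⟩ hcount
  rwa [div_mul_eq_mul_div, le_div_iff₀ (by linarith), mul_comm]
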